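/- Let (X,T) be a topological dynamical system and d ≥ 1. If there exists a continuous, injective, affine map Ψ : M(X) → ([0,1]^d)^ℤ satisfying Ψ ∘ T_* = σ_d ∘ Ψ, then either the number of ergodic T-invariant Borel probability measures is at most d and Mult(T) ≤ d, or the number of ergodic T-invariant Borel probability measures is exactly d + 1 and Mult(T) = d + 1. -/

import Mathlib

open MeasureTheory

/-- Iterates of a homeomorphism, indexed by natural numbers. -/
def hiterN {X : Type*} [TopologicalSpace X] (T : X ≃ₜ X) : ℕ → (X ≃ₜ X)
  | 0 => Homeomorph.refl X
  | n + 1 => (hiterN T n).trans T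

/-- Iterates of a homeomorphism, indexed by integers. -/
def hiter {X : Type*} [TopologicalSpace X] (T : X ≃ₜ X) : ℤ → (X ≃ₜ X)
  | Int.ofNat n => hiterN T n
  | Int.negSucc n => (hiterN T (n + 1)).symm

/-- The set of all iterates `f ∘ Tⁿ` for `f ∈ F` and `n ∈ ℤ`. -/
def iterSet {X : Type*} [TopologicalSpace X] (T : X ≃ₜ X) (F : Set C(X, ℝ)) :
    Set C(X, ℝ) :=
  {h | ∃ f ∈ F, ∃ n : ℤ, h = f.comp (hiter T n : C(X, X))}

/-- The topological multiplicity of `(X, T)`: the minimal cardinality (in `ℕ ∪ {∞}`) of a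
finite set `F ⊆ C(X)` whose iterates `f ∘ Tⁿ`, `f ∈ F`, `n ∈ ℤ`, span a dense subspace of
`C(X)`. -/
noncomputable def topMult {X : Type*} [TopologicalSpace X] (T : X ≃ₜ X) : ℕ∞ :=
  sInf {c : ℕ∞ | ∃ F : Finset C(X, ℝ), (F.card : ℕ∞) = c ∧
    Dense (Submodule.span ℝ (iterSet T (F : Set C(X, ℝ))) : Set C(X, ℝ))}

/-- The pushforward action `T_*` induced by a homeomorphism `T` on the space of Borel
probability measures. -/
noncomputable def pushForward {X : Type*} [TopologicalSpace X] [MeasurableSpace X]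
    [BorelSpace X] (T : X ≃ₜ X) (μ : ProbabilityMeasure X) : ProbabilityMeasure X :=
  μ.map (f := ⇑T) T.continuous.measurable.aemeasurable

/-- The convex combination `t μ + (1 - t) ν` of two Borel probability measures,
for `0 ≤ t ≤ 1`. -/
noncomputable def convComb {X : Type*} [MeasurableSpace X] (t : NNReal) (ht : t ≤ 1)
    (μ ν : ProbabilityMeasure X) : ProbabilityMeasure X :=
  ⟨(t : ENNReal) • (μ : Measure X) + ((1 - t : NNReal) : ENNReal) • (ν : Measure X), by
    constructor
    rw [Measure.add_apply, Measure.smul_apply, Measure.smul_apply, measure_univ, measure_univ,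
      smul_eq_mul, smul_eq_mul, mul_one, mul_one, ← ENNReal.coe_add,
      add_tsub_cancel_of_le ht, ENNReal.coe_one]⟩

open Filter Topology

set_option linter.unusedSectionVars false
set_option autoImplicit false
section PartA
variable {X : Type*} [MetricSpace X] [CompactSpace X] [MeasurableSpace X] [BorelSpace X]

theorem integrable_cm (g : C(X, ℝ)) (μ : Measure X) [IsFiniteMeasure μ] :
    Integrable (fun x => g x) μ :=
  (BoundedContinuousFunction.mkOfCompact g).integrable μ

/-- The functional on `C(X)` given by integration. -/
noncomputable def intF (μ : Measure X) [IsFiniteMeasure μ] : C(X, ℝ) →L[ℝ] ℝ :=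
  LinearMap.mkContinuous
    { toFun := fun g => ∫ x, g x ∂μ
      map_add' := fun f g => integral_add (integrable_cm f μ) (integrable_cm g μ)
      map_smul' := fun c f => integral_const_mul c _ } (μ.real Set.univ) (by
    intro f
    have := norm_integral_le_of_norm_le_const (μ := μ) (f := fun x => f x) (C := ‖f‖)
      (Eventually.of_forall fun x => f.norm_coe_le_norm x)
    simpa [mul_comm] using this)

@[simp] theorem intF_apply (μ : Measure X) [IsFiniteMeasure μ] (g : C(X, ℝ)) :
    intF μ g = ∫ x, g x ∂μ := rfl

theorem measure_ext_cm {μ ν : Measure X} [IsFiniteMeasure μ] [IsFiniteMeasure ν]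
    (h : ∀ g : C(X, ℝ), ∫ x, g x ∂μ = ∫ x, g x ∂ν) : μ = ν :=
  ext_of_forall_integral_eq_of_IsFiniteMeasure fun f => h f.toContinuousMap

theorem exists_pos_rep (A : C(X, ℝ) →ₗ[ℝ] ℝ) (hA : ∀ g, 0 ≤ g → 0 ≤ A g) :
    ∃ μ : Measure X, IsFiniteMeasure μ ∧ ∀ g : C(X, ℝ), A g = ∫ x, g x ∂μ := by
  let Λ : CompactlySupportedContinuousMap X ℝ →ₚ[ℝ] ℝ := PositiveLinearMap.mk₀
    { toFun := fun f => A f.toContinuousMap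
      map_add' := fun f g => A.map_add _ _
      map_smul' := fun c f => A.map_smul c _ } (fun f hf => hA _ hf)
  refine ⟨RealRMK.rieszMeasure Λ, inferInstance, fun g => ?_⟩
  have := RealRMK.integral_rieszMeasure Λ (CompactlySupportedContinuousMap.continuousMapEquiv g)
  exact this.symm

theorem exists_signed_rep (L : C(X, ℝ) →L[ℝ] ℝ) :
    ∃ α β : Measure X, IsFiniteMeasure α ∧ IsFiniteMeasure β ∧
      ∀ g : C(X, ℝ), L g = ∫ x, g x ∂α - ∫ x, g x ∂β := by
  rcases isEmpty_or_nonempty X with hX | ⟨⟨x0⟩⟩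
  · refine ⟨0, 0, inferInstance, inferInstance, fun g => ?_⟩
    have : g = 0 := by ext x; exact hX.elim x
    simp [this]
  let D : Submodule ℝ (C(X, ℝ) × C(X, ℝ)) :=
    { carrier := {p | ∀ x, p.1 x + p.2 x = p.1 x0 + p.2 x0}
      add_mem' := by
        intro a b ha hb x
        have := ha x; have := hb x
        simp only [Prod.fst_add, Prod.snd_add, ContinuousMap.add_apply]; linarith
      zero_mem' := by intro x; simp
      smul_mem' := by
        intro c a ha x
        have := ha x
        simp only [Prod.smul_fst, Prod.smul_snd, ContinuousMap.smul_apply, smul_eq_mul,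
          ← mul_add, this] }
  let F : (C(X, ℝ) × C(X, ℝ)) →ₗ[ℝ] ℝ :=
    { toFun := fun p => - L p.2 + ‖L‖ * (p.1 x0 + p.2 x0)
      map_add' := by intro a b; simp; ring
      map_smul' := by intro c a; simp; ring }
  obtain ⟨G, hG1, hG2⟩ := riesz_extension (PointedCone.positive ℝ (C(X, ℝ) × C(X, ℝ))) ⟨D, F.domRestrict D⟩
    (by
      rintro ⟨⟨u, w⟩, hp⟩ hpos
      have hpos' : (0 : (C(X, ℝ) × C(X, ℝ))) ≤ (u, w) := hpos
      have hu : 0 ≤ u := hpos'.1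
      have hw : 0 ≤ w := hpos'.2
      have hc : ‖w‖ ≤ u x0 + w x0 := by
        have hu0 : 0 ≤ u x0 := hu x0
        have hw0 : 0 ≤ w x0 := hw x0
        rw [ContinuousMap.norm_le _ (add_nonneg hu0 hw0)]
        intro x
        have h1 : u x + w x = u x0 + w x0 := hp x
        have h2 : 0 ≤ w x := hw x
        have h3 : 0 ≤ u x := hu x
        rw [Real.norm_of_nonneg h2]; linarith
      have h4 : L w ≤ ‖L‖ * ‖w‖ := (le_abs_self _).trans (L.le_opNorm w)
      have h5 : ‖L‖ * ‖w‖ ≤ ‖L‖ * (u x0 + w x0) := by gcongr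
      change 0 ≤ - L w + ‖L‖ * (u x0 + w x0)
      linarith)
    (by
      rintro ⟨u, w⟩
      refine ⟨⟨(ContinuousMap.const X ‖u‖, ContinuousMap.const X ‖w‖), fun x => rfl⟩, ?_⟩
      change (0 : (C(X, ℝ) × C(X, ℝ))) ≤ _
      constructor
      · intro x
        have := (abs_le.1 (u.norm_coe_le_norm x)).1
        change 0 ≤ ‖u‖ + u x
        linarith
      · intro x
        have := (abs_le.1 (w.norm_coe_le_norm x)).1
        change 0 ≤ ‖w‖ + w x
        linarith)
  obtain ⟨α, hα, hα'⟩ := exists_pos_rep (G ∘ₗ LinearMap.inl ℝ _ _)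
    (fun g hg => hG2 _ (show (0 : (C(X, ℝ) × C(X, ℝ))) ≤ (g, 0) from ⟨hg, le_rfl⟩))
  obtain ⟨β, hβ, hβ'⟩ := exists_pos_rep (G ∘ₗ LinearMap.inr ℝ _ _)
    (fun g hg => hG2 _ (show (0 : (C(X, ℝ) × C(X, ℝ))) ≤ (0, g) from ⟨le_rfl, hg⟩))
  refine ⟨α, β, hα, hβ, fun g => ?_⟩
  rw [← hα', ← hβ']
  have h := hG1 ⟨(g, -g), fun x => by simp⟩
  have h2 : G (g, -g) = L g := by
    refine h.trans ?_
    change - L (-g) + ‖L‖ * (g x0 + (-g) x0) = L g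
    simp
  rw [← h2, LinearMap.comp_apply, LinearMap.comp_apply, ← map_sub]
  congr 1
  ext x <;> simp

/-- density criterion -/
theorem dense_of_forall (S : Submodule ℝ C(X, ℝ))
    (h : ∀ L : C(X, ℝ) →L[ℝ] ℝ, (∀ g ∈ S, L g = 0) → L = 0) : Dense (S : Set C(X, ℝ)) := by
  by_contra hS
  obtain ⟨x, hx⟩ : ∃ x, x ∉ closure (S : Set C(X, ℝ)) := by
    simpa [Dense] using hS
  have hx' : x ∉ (S.topologicalClosure : Set C(X, ℝ)) := by
    rwa [Submodule.topologicalClosure_coe]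
  obtain ⟨f, u, hf, hu⟩ := geometric_hahn_banach_closed_point
    (S.topologicalClosure.convex) (S.isClosed_topologicalClosure) hx'
  have h0 : ∀ g ∈ S, f g = 0 := by
    intro g hg
    by_contra hne
    have := hf ((u / f g) • g) (S.topologicalClosure.smul_mem _ (S.le_topologicalClosure hg))
    rw [map_smul, smul_eq_mul, div_mul_cancel₀ _ hne] at this
    exact lt_irrefl _ this
  have := h f h0
  have h1 := hf 0 (Submodule.zero_mem _)
  simp [this] at h1 hu
  linarith

theorem eq_of_dense {S : Submodule ℝ C(X, ℝ)} (hS : Dense (S : Set C(X, ℝ)))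
    {L : C(X, ℝ) →L[ℝ] ℝ} (h : ∀ g ∈ S, L g = 0) : L = 0 := by
  have : (L : C(X, ℝ) → ℝ) = (0 : C(X, ℝ) →L[ℝ] ℝ) :=
    Continuous.ext_on hS L.continuous (0 : C(X, ℝ) →L[ℝ] ℝ).continuous (fun g hg => h g hg)
  exact DFunLike.coe_injective this

theorem integral_comp_homeo (T : X ≃ₜ X) (μ : Measure X) (g : C(X, ℝ)) :
    ∫ x, g x ∂(μ.map T) = ∫ x, g (T x) ∂μ :=
  integral_map T.continuous.measurable.aemeasurable g.continuous.aestronglyMeasurable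

/-- Invariant functionals are differences of invariant measures. -/
theorem exists_inv_rep (T : X ≃ₜ X) (L : C(X, ℝ) →L[ℝ] ℝ)
    (hL : ∀ g : C(X, ℝ), L (g.comp (T : C(X, X))) = L g) :
    ∃ α β : Measure X, ∃ _ : IsFiniteMeasure α, ∃ _ : IsFiniteMeasure β,
      MeasurePreserving T α α ∧ MeasurePreserving T β β ∧ L = intF α - intF β := by
  obtain ⟨α, β, hα, hβ, h⟩ := exists_signed_rep L
  have hT : Measurable T := T.continuous.measurable
  have hsum : α + β.map T = α.map T + β := by
    have : IsFiniteMeasure (α.map T) := Measure.isFiniteMeasure_map α T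
    have : IsFiniteMeasure (β.map T) := Measure.isFiniteMeasure_map β T
    apply measure_ext_cm
    intro g
    rw [integral_add_measure (integrable_cm g _) (integrable_cm g _),
      integral_add_measure (integrable_cm g _) (integrable_cm g _),
      integral_comp_homeo, integral_comp_homeo]
    have h1 := h g
    have h2 := h (g.comp (T : C(X, X)))
    rw [hL, h1] at h2
    simp only [ContinuousMap.comp_apply, ContinuousMap.coe_coe] at h2
    linarith
  have key : ∀ t, MeasurableSet t → (α (T ⁻¹' t)).toReal - (β (T ⁻¹' t)).toReal
      = (α t).toReal - (β t).toReal := by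
    intro t ht
    have h3 := congrArg (fun m : Measure X => (m t).toReal) hsum
    simp only [Measure.add_apply, Measure.map_apply hT ht] at h3
    rw [ENNReal.toReal_add (by finiteness) (by finiteness),
      ENNReal.toReal_add (by finiteness) (by finiteness)] at h3
    linarith
  set s : SignedMeasure X := α.toSignedMeasure - β.toSignedMeasure with hs
  set J := s.toJordanDecomposition with hJ
  have hsJ : s = J.toSignedMeasure := (s.toSignedMeasure_toJordanDecomposition).symm
  have hval : ∀ t, MeasurableSet t → (α t).toReal - (β t).toReal =
      (J.posPart t).toReal - (J.negPart t).toReal := by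
    intro t ht
    have h3 := congrArg (fun m : SignedMeasure X => m t) hsJ
    simpa [hs, JordanDecomposition.toSignedMeasure, Measure.toSignedMeasure_apply_measurable ht,
      measureReal_def] using h3
  let J' : JordanDecomposition X :=
    { posPart := J.posPart.map T
      negPart := J.negPart.map T
      posPart_finite := Measure.isFiniteMeasure_map _ _
      negPart_finite := Measure.isFiniteMeasure_map _ _
      mutuallySingular := by
        obtain ⟨u, hu, h1, h2⟩ := J.mutuallySingular
        refine ⟨T.symm ⁻¹' u, T.symm.continuous.measurable hu, ?_, ?_⟩
        · rw [Measure.map_apply hT (T.symm.continuous.measurable hu), ← Set.preimage_comp]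
          simpa using h1
        · rw [Measure.map_apply hT (T.symm.continuous.measurable hu).compl,
            ← Set.preimage_compl, ← Set.preimage_comp]
          simpa using h2 }
  have hJJ : J = J' := by
    apply JordanDecomposition.toSignedMeasure_injective
    rw [← hsJ]
    ext t ht
    have e1 := key t ht
    rw [hval _ ht, hval _ (hT ht)] at e1
    have h3 := congrArg (fun m : SignedMeasure X => m t) hsJ
    refine h3.trans ?_
    have := J'.posPart_finite
    have := J'.negPart_finite
    simp only [JordanDecomposition.toSignedMeasure, sub_apply,
      Measure.toSignedMeasure_apply_measurable ht, measureReal_def]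
    change _ = ((J.posPart.map T) t).toReal - ((J.negPart.map T) t).toReal
    rw [Measure.map_apply hT ht, Measure.map_apply hT ht]
    exact e1.symm
  refine ⟨J.posPart, J.negPart, inferInstance, inferInstance, ⟨hT, ?_⟩, ⟨hT, ?_⟩, ?_⟩
  · exact (congrArg JordanDecomposition.posPart hJJ).symm
  · exact (congrArg JordanDecomposition.negPart hJJ).symm
  · have hsum2 : α + J.negPart = J.posPart + β := by
      ext t ht
      have := hval t ht
      rw [Measure.add_apply, Measure.add_apply,
        ← ENNReal.toReal_eq_toReal_iff' (by finiteness) (by finiteness),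
        ENNReal.toReal_add (by finiteness) (by finiteness),
        ENNReal.toReal_add (by finiteness) (by finiteness)]
      linarith
    ext g
    have h3 := congrArg (fun m : Measure X => ∫ x, g x ∂m) hsum2
    rw [integral_add_measure (integrable_cm g _) (integrable_cm g _),
      integral_add_measure (integrable_cm g _) (integrable_cm g _)] at h3
    rw [h, sub_apply, intF_apply, intF_apply]
    linarith
end PartA
section PartB
variable {X : Type*} [MetricSpace X] [CompactSpace X] [MeasurableSpace X] [BorelSpace X]

theorem integral_convComb (t : NNReal) (ht : t ≤ 1) (μ ν : ProbabilityMeasure X) (g : C(X, ℝ)) :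
    ∫ x, g x ∂(convComb t ht μ ν : Measure X) =
      t * ∫ x, g x ∂(μ : Measure X) + (1 - t) * ∫ x, g x ∂(ν : Measure X) := by
  change ∫ x, g x ∂((t : ENNReal) • (μ : Measure X) +
    ((1 - t : NNReal) : ENNReal) • (ν : Measure X)) = _
  rw [integral_add_measure ((integrable_cm g _).smul_measure (by finiteness))
    ((integrable_cm g _).smul_measure (by finiteness)), integral_smul_measure,
    integral_smul_measure]
  rw [ENNReal.coe_toReal, ENNReal.coe_toReal, NNReal.coe_sub ht]
  simp

theorem finite_rep (Φ : ProbabilityMeasure X → ℝ) (f : C(X, ℝ))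
    (hf : ∀ x, f x = Φ (diracProba x))
    (haff : ∀ (μ ν : ProbabilityMeasure X) (t : NNReal) (ht : t ≤ 1),
      Φ (convComb t ht μ ν) = (t : ℝ) * Φ μ + (1 - (t : ℝ)) * Φ ν) (S : Finset X) :
    ∀ μ : ProbabilityMeasure X, (μ : Measure X) (S : Set X)ᶜ = 0 →
      Φ μ = ∫ x, f x ∂(μ : Measure X) := by
  classical
  have hdirac : ∀ a, Φ (diracProba a) = ∫ x, f x ∂(diracProba a : Measure X) := by
    intro a
    rw [← hf]
    change _ = ∫ x, f x ∂(Measure.dirac a)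
    rw [integral_dirac]
  induction S using Finset.induction_on with
  | empty => intro μ h; simp at h
  | insert a S ha ih =>
    intro μ h
    have hsplit : (μ : Measure X) = (μ : Measure X) {a} • Measure.dirac a +
        (μ : Measure X).restrict {a}ᶜ := by
      rw [← Measure.restrict_singleton, Measure.restrict_add_restrict_compl
        (measurableSet_singleton a)]
    by_cases h1 : (μ : Measure X) {a}ᶜ = 0
    · have h2 : (μ : Measure X) {a} = 1 := by
        rw [prob_compl_eq_zero_iff (measurableSet_singleton a)] at h1; exact h1
      have : μ = diracProba a := by
        apply Subtype.ext
        rw [← Measure.restrict_eq_zero] at h1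
        change (μ : Measure X) = Measure.dirac a
        rw [hsplit, h1, h2]; simp
      rw [this]; exact hdirac a
    · have hν : IsProbabilityMeasure (ProbabilityTheory.cond (μ : Measure X) {a}ᶜ) :=
        ProbabilityTheory.cond_isProbabilityMeasure h1
      let ν : ProbabilityMeasure X := ⟨ProbabilityTheory.cond (μ : Measure X) {a}ᶜ, hν⟩
      have hνS : (ν : Measure X) (S : Set X)ᶜ = 0 := by
        change ProbabilityTheory.cond (μ : Measure X) {a}ᶜ (S : Set X)ᶜ = 0
        rw [ProbabilityTheory.cond_apply (measurableSet_singleton a).compl]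
        have : ({a}ᶜ ∩ (S : Set X)ᶜ) = ((insert a S : Finset X) : Set X)ᶜ := by
          ext x; simp
        rw [this, h, mul_zero]
      have ht : μ {a} ≤ 1 := μ.apply_le_one {a}
      have hμ : μ = convComb (μ {a}) ht (diracProba a) ν := by
        apply Subtype.ext
        change (μ : Measure X) = ((μ {a} : NNReal) : ENNReal) • Measure.dirac a +
          ((1 - μ {a} : NNReal) : ENNReal) • ProbabilityTheory.cond (μ : Measure X) {a}ᶜ
        rw [ENNReal.coe_sub, ENNReal.coe_one, μ.ennreal_coeFn_eq_coeFn_toMeasure,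
          ← prob_compl_eq_one_sub (measurableSet_singleton a), ProbabilityTheory.cond,
          smul_smul, ENNReal.mul_inv_cancel h1 (by finiteness), one_smul]
        exact hsplit
      rw [hμ, haff, integral_convComb, ih ν hνS, hdirac]

theorem affine_rep (Φ : ProbabilityMeasure X → ℝ) (hΦ : Continuous Φ) (f : C(X, ℝ))
    (hf : ∀ x, f x = Φ (diracProba x))
    (haff : ∀ (μ ν : ProbabilityMeasure X) (t : NNReal) (ht : t ≤ 1),
      Φ (convComb t ht μ ν) = (t : ℝ) * Φ μ + (1 - (t : ℝ)) * Φ ν)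
    (μ : ProbabilityMeasure X) : Φ μ = ∫ x, f x ∂(μ : Measure X) := by
  obtain ⟨x0⟩ : Nonempty X := μ.nonempty
  let s : ℕ → SimpleFunc X X := SimpleFunc.approxOn id measurable_id Set.univ x0 (Set.mem_univ _)
  have hs : ∀ x, Tendsto (fun n => s n x) atTop (𝓝 x) := fun x =>
    SimpleFunc.tendsto_approxOn measurable_id (Set.mem_univ x0) (by simp)
  let m : ℕ → ProbabilityMeasure X := fun n => μ.map (s n).measurable.aemeasurable
  have hint : ∀ (g : C(X, ℝ)) n, ∫ x, g x ∂(m n : Measure X) = ∫ x, g (s n x) ∂(μ : Measure X) :=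
    fun g n => integral_map (s n).measurable.aemeasurable g.continuous.aestronglyMeasurable
  have hconv : ∀ g : C(X, ℝ), Tendsto (fun n => ∫ x, g x ∂(m n : Measure X)) atTop
      (𝓝 (∫ x, g x ∂(μ : Measure X))) := by
    intro g
    simp_rw [hint]
    apply tendsto_integral_of_dominated_convergence (fun _ => ‖g‖)
    · intro n
      exact (g.continuous.measurable.comp (s n).measurable).aestronglyMeasurable
    · exact integrable_const _
    · intro n
      exact Eventually.of_forall fun x => g.norm_coe_le_norm _
    · exact Eventually.of_forall fun x => (g.continuous.tendsto x).comp (hs x)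
  have hm : Tendsto m atTop (𝓝 μ) := by
    rw [ProbabilityMeasure.tendsto_iff_forall_integral_tendsto]
    intro g
    exact hconv g.toContinuousMap
  have h1 : ∀ n, Φ (m n) = ∫ x, f x ∂(m n : Measure X) := by
    intro n
    apply finite_rep Φ f hf haff (s n).range
    change (Measure.map (s n) (μ : Measure X)) _ = 0
    rw [Measure.map_apply (s n).measurable (Finset.measurableSet _).compl]
    have : (s n) ⁻¹' (((s n).range : Set X))ᶜ = ∅ := by
      ext x; simp
    rw [this]; simp
  have h2 := (hΦ.tendsto μ).comp hm
  have h3 := hconv f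
  refine tendsto_nhds_unique h2 ?_
  simpa [Function.comp_def, h1] using h3

theorem hiterN_apply (T : X ≃ₜ X) (n : ℕ) (x : X) : hiterN T n x = T^[n] x := by
  induction n with
  | zero => rfl
  | succ n ih =>
    rw [Function.iterate_succ_apply', ← ih]; rfl

theorem hiter_zero (T : X ≃ₜ X) (x : X) : hiter T 0 x = x := rfl

theorem hiter_succ (T : X ≃ₜ X) (n : ℤ) (x : X) : hiter T (n + 1) x = T (hiter T n x) := by
  rcases n with n | n
  · rfl
  · rcases n with _ | n
    · change x = T ((hiterN T 1).symm x)
      exact ((hiterN T 1).apply_symm_apply x).symm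
    · have : Int.negSucc (n + 1) + 1 = Int.negSucc n := by omega
      rw [this]
      change (hiterN T (n + 1)).symm x = T ((hiterN T (n + 2)).symm x)
      rw [Homeomorph.symm_apply_eq, hiterN_apply, ← Function.iterate_succ_apply, ← hiterN_apply,
        Homeomorph.apply_symm_apply]

theorem hiter_succ' (T : X ≃ₜ X) (n : ℤ) (x : X) : hiter T (n + 1) x = hiter T n (T x) := by
  induction n using Int.induction_on with
  | zero => rfl
  | succ n ih => rw [hiter_succ, ih, ← hiter_succ]
  | pred n ih =>
    apply T.injective
    rw [← hiter_succ, ← hiter_succ, show -(n : ℤ) - 1 + 1 + 1 = -n + 1 by ring, ih,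
      show -(n : ℤ) - 1 + 1 = -n by ring]

theorem inv_hiter (T : X ≃ₜ X) (L : C(X, ℝ) →L[ℝ] ℝ)
    (hL : ∀ g : C(X, ℝ), L (g.comp (T : C(X, X))) = L g) (g : C(X, ℝ)) (n : ℤ) :
    L (g.comp (hiter T n : C(X, X))) = L g := by
  have hstep : ∀ n : ℤ, L (g.comp (hiter T (n + 1) : C(X, X))) =
      L (g.comp (hiter T n : C(X, X))) := by
    intro n
    rw [← hL (g.comp (hiter T n : C(X, X)))]
    congr 1
    ext x
    simp [hiter_succ']
  induction n using Int.induction_on with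
  | zero => congr 1
  | succ n ih => rw [hstep, ih]
  | pred n ih => rw [← ih, ← hstep]; congr 4; ring

theorem pushForward_dirac (T : X ≃ₜ X) (x : X) :
    pushForward T (diracProba x) = diracProba (T x) := by
  apply Subtype.ext
  change Measure.map T (Measure.dirac x) = Measure.dirac (T x)
  exact Measure.map_dirac' T.continuous.measurable _

/-- Main structural consequence of the hypothesis. -/
theorem exists_funcs (T : X ≃ₜ X) (d : ℕ)
    (Ψ : ProbabilityMeasure X → (ℤ → Fin d → unitInterval))
    (hΨcont : Continuous Ψ) (hΨinj : Function.Injective Ψ)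
    (hΨequiv : ∀ μ : ProbabilityMeasure X, Ψ (pushForward T μ) = fun n => Ψ μ (n + 1))
    (hΨaffine : ∀ (μ ν : ProbabilityMeasure X) (t : NNReal) (ht : t ≤ 1) (n : ℤ) (i : Fin d),
      (Ψ (convComb t ht μ ν) n i : ℝ)
        = (t : ℝ) * (Ψ μ n i : ℝ) + (1 - (t : ℝ)) * (Ψ ν n i : ℝ)) :
    ∃ f : Fin d → C(X, ℝ), ∀ L : C(X, ℝ) →L[ℝ] ℝ, L 1 = 0 →
      (∀ i n, L ((f i).comp (hiter T n : C(X, X))) = 0) → L = 0 := by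
  let f : Fin d → C(X, ℝ) := fun i => ⟨fun x => (Ψ (diracProba x) 0 i : ℝ), by
    have h1 : Continuous fun x : X => Ψ (diracProba x) := hΨcont.comp continuous_diracProba
    exact continuous_subtype_val.comp ((continuous_apply i).comp ((continuous_apply 0).comp h1))⟩
  have hiter_dirac : ∀ (n : ℤ) (x : X), Ψ (diracProba (hiter T n x)) 0 = Ψ (diracProba x) n := by
    have hgen : ∀ (n k : ℤ) (x : X), Ψ (diracProba (hiter T n x)) k =
        Ψ (diracProba x) (k + n) := by
      have step : ∀ (x : X) (k : ℤ), Ψ (diracProba (T x)) k = Ψ (diracProba x) (k + 1) := by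
        intro x k
        rw [← pushForward_dirac, hΨequiv]
      intro n
      induction n using Int.induction_on with
      | zero => intro k x; rw [hiter_zero, add_zero]
      | succ n ih => intro k x; rw [hiter_succ, step, ih]; congr 1; ring
      | pred n ih =>
        intro k x
        have := step (hiter T (-(n : ℤ) - 1) x) (k - 1)
        rw [← hiter_succ, show -(n : ℤ) - 1 + 1 = -n by ring, ih,
          show k - 1 + 1 = k by ring] at this
        rw [← this]; congr 1; ring
    intro n x
    rw [hgen, zero_add]
  have hrep : ∀ (μ : ProbabilityMeasure X) n i, (Ψ μ n i : ℝ) =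
      ∫ x, ((f i).comp (hiter T n : C(X, X))) x ∂(μ : Measure X) := by
    intro μ n i
    apply affine_rep (fun μ => (Ψ μ n i : ℝ)) (by fun_prop)
    · intro x
      change (Ψ (diracProba (hiter T n x)) 0 i : ℝ) = _
      rw [hiter_dirac]
    · intro μ ν t ht
      exact hΨaffine μ ν t ht n i
  refine ⟨f, fun L h1 hL => ?_⟩
  obtain ⟨α, β, hα, hβ, h⟩ := exists_signed_rep L
  have hmass : α.real Set.univ = β.real Set.univ := by
    have := h 1
    rw [h1] at this
    simp at this
    linarith
  have hmass' : α Set.univ = β Set.univ := by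
    rwa [measureReal_def, measureReal_def, ENNReal.toReal_eq_toReal_iff' (by finiteness)
      (by finiteness)] at hmass
  suffices α = β by
    ext g; rw [h, this]; simp
  by_cases h0 : α Set.univ = 0
  · have h0' : β Set.univ = 0 := by rw [← hmass', h0]
    rw [Measure.measure_univ_eq_zero.1 h0, Measure.measure_univ_eq_zero.1 h0']
  have hα1 : IsProbabilityMeasure ((α Set.univ)⁻¹ • α) :=
    ⟨by simp [ENNReal.inv_mul_cancel h0 (measure_ne_top α _)]⟩
  have hβ1 : IsProbabilityMeasure ((α Set.univ)⁻¹ • β) :=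
    ⟨by simp [← hmass', ENNReal.inv_mul_cancel h0 (measure_ne_top α _)]⟩
  have hEq : (⟨_, hα1⟩ : ProbabilityMeasure X) = ⟨_, hβ1⟩ := by
    apply hΨinj
    funext n i
    apply Subtype.ext
    refine (hrep _ n i).trans (Eq.trans ?_ (hrep _ n i).symm)
    change ∫ x, _ ∂((α Set.univ)⁻¹ • α) = ∫ x, _ ∂((α Set.univ)⁻¹ • β)
    rw [integral_smul_measure, integral_smul_measure]
    congr 1
    have := h ((f i).comp (hiter T n : C(X, X)))
    rw [hL] at this
    linarith
  have hEq' : (α Set.univ)⁻¹ • α = (α Set.univ)⁻¹ • β := congrArg Subtype.val hEq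
  have := congrArg (fun m => α Set.univ • m) hEq'
  simpa [smul_smul, ENNReal.mul_inv_cancel h0 (measure_ne_top α _)] using this

end PartB
section PartC
variable {X : Type*} [MetricSpace X] [CompactSpace X] [MeasurableSpace X] [BorelSpace X]

theorem linIndep_intF {ι : Type*} [Fintype ι] (ν : ι → Measure X) [∀ j, IsFiniteMeasure (ν j)]
    (B : ι → Set X) (h1 : ∀ j, ν j (B j) ≠ 0)
    (h2 : ∀ i j, i ≠ j → ν i (B j) = 0) : LinearIndependent ℝ (fun j => intF (ν j)) := by
  rw [Fintype.linearIndependent_iff]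
  intro c hc j
  let P : (ι → ℝ) → Measure X := fun a => ∑ i, (Real.toNNReal (a i)) • ν i
  have hPfin : ∀ a, IsFiniteMeasure (P a) := fun a => inferInstance
  have hPint : ∀ a (g : C(X, ℝ)), ∫ x, g x ∂(P a) =
      ∑ i, ((Real.toNNReal (a i) : NNReal) : ℝ) * ∫ x, g x ∂(ν i) := by
    intro a g
    rw [integral_finsetSum_measure (fun i _ => integrable_cm g _)]
    exact Finset.sum_congr rfl fun i _ => by rw [integral_smul_nnreal_measure]; rfl
  have hPB : ∀ a, P a (B j) = (Real.toNNReal (a j) : ENNReal) * ν j (B j) := by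
    intro a
    simp only [P, Measure.coe_finsetSum, Finset.sum_apply, Measure.smul_apply]
    rw [Finset.sum_eq_single j]
    · rfl
    · intro i _ hij; rw [h2 i j hij, smul_zero]
    · simp
  have hEq : P c = P (-c) := by
    apply measure_ext_cm
    intro g
    rw [hPint, hPint, ← sub_eq_zero, ← Finset.sum_sub_distrib]
    have := congrArg (fun L : C(X, ℝ) →L[ℝ] ℝ => L g) hc
    simp only [sum_apply, smul_apply, intF_apply, zero_apply, smul_eq_mul] at this
    rw [← this]
    refine Finset.sum_congr rfl fun i _ => ?_
    rw [← sub_mul]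
    congr 1
    simp only [Real.coe_toNNReal', Pi.neg_apply]
    rcases le_total (c i) 0 with h | h
    · rw [max_eq_right h, max_eq_left (by linarith)]; ring
    · rw [max_eq_left h, max_eq_right (by linarith)]; ring
  have := congrArg (fun m : Measure X => m (B j)) hEq
  simp only [hPB, Pi.neg_apply] at this
  rw [ENNReal.mul_left_inj (h1 j) (by finiteness), ENNReal.coe_inj] at this
  have h3 := congrArg NNReal.toReal this
  simp only [Real.coe_toNNReal'] at h3
  rcases le_total (c j) 0 with h | h
  · rw [max_eq_right h, max_eq_left (by linarith)] at h3; linarith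
  · rw [max_eq_left h, max_eq_right (by linarith)] at h3; linarith

theorem ergodic_singular {T : X → X} {μ ν : Measure X} [IsProbabilityMeasure μ]
    [IsProbabilityMeasure ν] (hμ : Ergodic T μ) (hν : Ergodic T ν) (hne : μ ≠ ν) :
    μ.MutuallySingular ν := by
  have h1 := hμ.toMeasurePreserving.withDensity_rnDeriv hν.toMeasurePreserving
  obtain ⟨c, hc⟩ := hν.eq_smul_of_absolutelyContinuous h1 (withDensity_absolutelyContinuous _ _)
  have hdec := Measure.rnDeriv_add_singularPart μ ν
  by_cases h0 : c = 0
  · rw [hc, h0, zero_smul, zero_add] at hdec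
    rw [← hdec]
    exact Measure.mutuallySingular_singularPart _ _
  · exfalso
    apply hne
    have hac : ν ≪ μ := by
      have h2 : c • ν ≤ μ := by
        rw [← hc]; exact Measure.withDensity_rnDeriv_le μ ν
      exact (Measure.absolutelyContinuous_smul h0).trans (Measure.absolutelyContinuous_of_le h2)
    exact (hμ.eq_of_absolutelyContinuous hν.toMeasurePreserving hac).symm

theorem linIndep_ergodic {T : X → X} {ι : Type*} [Fintype ι] (e : ι → Measure X)
    [∀ j, IsProbabilityMeasure (e j)] (he : ∀ j, Ergodic T (e j)) (hinj : Function.Injective e) :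
    LinearIndependent ℝ (fun j => intF (e j)) := by
  classical
  have hs : ∀ i j : ι, ∃ S : Set X, MeasurableSet S ∧ (i ≠ j → e i S = 0 ∧ e j Sᶜ = 0) := by
    intro i j
    by_cases h : i = j
    · exact ⟨∅, MeasurableSet.empty, fun h' => absurd h h'⟩
    · obtain ⟨S, hS, h1, h2⟩ := ergodic_singular (he i) (he j) (fun h' => h (hinj h'))
      exact ⟨S, hS, fun _ => ⟨h1, h2⟩⟩
  choose S hSm hS using hs
  refine linIndep_intF e (fun j => ⋂ i ∈ {i : ι | i ≠ j}, S i j) ?_ ?_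
  · intro j h0
    have h1 : e j (⋂ i ∈ {i : ι | i ≠ j}, S i j)ᶜ = 0 := by
      rw [Set.compl_iInter₂]
      rw [measure_biUnion_null_iff (Set.to_countable _)]
      intro i hi
      exact (hS i j hi).2
    have h2 : e j Set.univ ≤ 0 := by
      rw [← Set.union_compl_self (⋂ i ∈ {i : ι | i ≠ j}, S i j)]
      refine (measure_union_le _ _).trans ?_
      rw [h0, h1, add_zero]
    rw [measure_univ] at h2
    simp at h2
  · intro i j hij
    exact measure_mono_null (Set.biInter_subset_of_mem (show i ∈ {i : ι | i ≠ j} from hij))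
      (hS i j hij).1

theorem intF_inv (T : X ≃ₜ X) (μ : Measure X) [IsFiniteMeasure μ] (h : MeasurePreserving T μ μ)
    (g : C(X, ℝ)) : intF μ (g.comp (T : C(X, X))) = intF μ g := by
  have := integral_comp_homeo T μ g
  rw [h.map_eq] at this
  exact this.symm

theorem card_le_of_linIndep (T : X ≃ₜ X) (F : Finset C(X, ℝ))
    (hF : Dense (Submodule.span ℝ (iterSet T (F : Set C(X, ℝ))) : Set C(X, ℝ)))
    {ι : Type*} [Fintype ι] (I : ι → (C(X, ℝ) →L[ℝ] ℝ))
    (hI : ∀ j (g : C(X, ℝ)), I j (g.comp (T : C(X, X))) = I j g)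
    (hlin : LinearIndependent ℝ I) : Fintype.card ι ≤ F.card := by
  let φ : (ι → ℝ) →ₗ[ℝ] (F → ℝ) :=
    { toFun := fun c f => ∑ j, c j * I j f
      map_add' := by
        intro a b; funext f; simp [add_mul, Finset.sum_add_distrib]
      map_smul' := by
        intro r a; funext f; simp [Finset.mul_sum, mul_assoc] }
  have hφ : Function.Injective φ := by
    rw [← LinearMap.ker_eq_bot, LinearMap.ker_eq_bot']
    intro c hc
    have hsum : ∑ j, c j • I j = 0 := by
      apply eq_of_dense hF
      intro g hg
      have hinv : ∀ g : C(X, ℝ), (∑ j, c j • I j) (g.comp (T : C(X, X))) =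
          (∑ j, c j • I j) g := by
        intro g
        simp [sum_apply, hI]
      induction hg using Submodule.span_induction with
      | mem x hx =>
        obtain ⟨f, hf, n, rfl⟩ := hx
        rw [inv_hiter T _ hinv]
        have := congrFun hc ⟨f, hf⟩
        simpa [φ, sum_apply] using this
      | zero => simp
      | add x y _ _ hx hy => rw [map_add, hx, hy, add_zero]
      | smul r x _ hx => rw [map_smul, hx, smul_zero]
    funext j
    exact Fintype.linearIndependent_iff.1 hlin c hsum j
  have := LinearMap.finrank_le_finrank_of_injective hφ
  simpa using this

/-- Finite ergodic decomposition. -/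
theorem mem_span_ergodic (T : X ≃ₜ X) (S : Submodule ℝ (C(X, ℝ) →L[ℝ] ℝ))
    (hS : ∀ (e : Measure X) [IsProbabilityMeasure e], Ergodic T e → intF e ∈ S) (n : ℕ) :
    ∀ (μ : Measure X) [IsFiniteMeasure μ], MeasurePreserving T μ μ →
      (∀ A : Fin (n + 1) → Set X, (∀ j, MeasurableSet (A j)) → (∀ j, T ⁻¹' (A j) = A j) →
        Pairwise (fun i j => Disjoint (A i) (A j)) → ∃ j, μ (A j) = 0) → intF μ ∈ S := by
  have hzero : ∀ (μ : Measure X) [IsFiniteMeasure μ], μ = 0 → intF μ ∈ S := by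
    intro μ _ h
    have : intF μ = 0 := by ext g; simp [h]
    rw [this]; exact S.zero_mem
  have herg : ∀ (μ : Measure X) [IsFiniteMeasure μ], Ergodic T μ → intF μ ∈ S := by
    intro μ _ h
    by_cases h0 : μ Set.univ = 0
    · exact hzero μ (Measure.measure_univ_eq_zero.1 h0)
    have hp : IsProbabilityMeasure ((μ Set.univ)⁻¹ • μ) :=
      ⟨by simp [ENNReal.inv_mul_cancel h0 (measure_ne_top μ _)]⟩
    have h1 := hS ((μ Set.univ)⁻¹ • μ) (h.smul_measure _)
    have h2 := S.smul_mem (μ Set.univ).toReal h1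
    convert h2 using 1
    ext g
    rw [smul_apply, intF_apply, intF_apply, integral_smul_measure, smul_smul,
      ENNReal.toReal_inv, mul_inv_cancel₀, one_smul]
    exact (ENNReal.toReal_pos h0 (measure_ne_top _ _)).ne'
  induction n with
  | zero =>
    intro μ _ hμ h
    obtain ⟨j, hj⟩ := h (fun _ => Set.univ) (fun _ => MeasurableSet.univ) (fun _ => rfl)
      (fun i j hij => absurd (Fin.ext (by omega)) hij)
    exact hzero μ (Measure.measure_univ_eq_zero.1 hj)
  | succ n ih =>
    intro μ _ hμ h
    by_cases hE : Ergodic T μ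
    · exact herg μ hE
    have hA : ∃ A, MeasurableSet A ∧ T ⁻¹' A = A ∧ μ A ≠ 0 ∧ μ Aᶜ ≠ 0 := by
      by_contra hno
      apply hE
      refine ⟨hμ, ⟨?_⟩⟩
      intro s hs hTs
      by_contra H
      apply hno
      obtain ⟨h1, h2⟩ : μ s ≠ 0 ∧ μ sᶜ ≠ 0 := by
        simpa [eventuallyConst_set, ae_iff, and_comm] using! H
      exact ⟨s, hs, hTs, h1, h2⟩
    obtain ⟨A, hAm, hTA, hA1, hA2⟩ := hA
    have key : ∀ A, MeasurableSet A → T ⁻¹' A = A → μ Aᶜ ≠ 0 → intF (μ.restrict A) ∈ S := by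
      intro A hAm hTA hA2
      apply ih
      · have := hμ.restrict_preimage hAm
        rwa [hTA] at this
      · intro B hBm hTB hBd
        obtain ⟨j, hj⟩ := h (Fin.cons Aᶜ (fun j => B j ∩ A)) (by
            intro j
            refine Fin.cases ?_ (fun j => ?_) j
            · exact hAm.compl
            · exact (hBm j).inter hAm) (by
            intro j
            refine Fin.cases ?_ (fun j => ?_) j
            · simp [Set.preimage_compl, hTA]
            · simp [Set.preimage_inter, hTA, hTB]) (by
            intro i j
            refine Fin.cases ?_ (fun i => ?_) i <;> refine Fin.cases ?_ (fun j => ?_) j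
            · intro h; exact absurd rfl h
            · intro _
              simp only [Fin.cons_zero, Fin.cons_succ]
              exact Disjoint.mono_right Set.inter_subset_right disjoint_compl_left
            · intro _
              simp only [Fin.cons_zero, Fin.cons_succ]
              exact Disjoint.mono_left Set.inter_subset_right disjoint_compl_right
            · intro hij
              simp only [Fin.cons_succ]
              exact (hBd (fun h => hij (by rw [h]))).mono Set.inter_subset_left
                Set.inter_subset_left)
        revert hj
        refine Fin.cases ?_ (fun j => ?_) j
        · intro hj; exact absurd hj hA2
        · intro hj
          refine ⟨j, ?_⟩
          rw [Measure.restrict_apply (hBm j)]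
          exact hj
    have h1 := key A hAm hTA hA2
    have h2 := key Aᶜ hAm.compl (by rw [Set.preimage_compl, hTA]) (by rwa [compl_compl])
    convert S.add_mem h1 h2 using 1
    ext g
    rw [add_apply, intF_apply, intF_apply, intF_apply,
      ← integral_add_measure (integrable_cm g _) (integrable_cm g _),
      Measure.restrict_add_restrict_compl hAm]

end PartC
section PartD
variable {X : Type*} [MetricSpace X] [CompactSpace X] [MeasurableSpace X] [BorelSpace X]

theorem topMult_le (T : X ≃ₜ X) (F : Finset C(X, ℝ))
    (hF : Dense (Submodule.span ℝ (iterSet T (F : Set C(X, ℝ))) : Set C(X, ℝ))) :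
    topMult T ≤ (F.card : ℕ∞) := sInf_le ⟨F, rfl, hF⟩

theorem encard_le_topMult (T : X ≃ₜ X) :
    {μ : Measure X | IsProbabilityMeasure μ ∧ Ergodic (⇑T) μ}.encard ≤ topMult T := by
  apply le_sInf
  rintro c ⟨F, rfl, hF⟩
  by_contra hlt
  rw [not_le] at hlt
  have hlt' := Order.add_one_le_of_lt hlt
  obtain ⟨t, ht, hcard⟩ := Set.exists_subset_encard_eq hlt'
  have htfin : t.Finite := by
    apply Set.finite_of_encard_eq_coe (k := F.card + 1)
    rw [hcard]; rfl
  have := htfin.fintype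
  have : ∀ e : t, IsProbabilityMeasure (e : Measure X) := fun e => (ht e.2).1
  have hle := card_le_of_linIndep T F hF (fun e : t => intF (e : Measure X))
    (fun e g => intF_inv T _ (ht e.2).2.toMeasurePreserving g)
    (linIndep_ergodic (fun e : t => (e : Measure X)) (fun e => (ht e.2).2)
      Subtype.val_injective)
  rw [Set.encard_eq_coe_toFinset_card, Set.toFinset_card] at hcard
  have hc : Fintype.card t = F.card + 1 := by exact_mod_cast hcard
  omega

theorem main_aux (T : X ≃ₜ X) (d : ℕ) (f : Fin d → C(X, ℝ))
    (hf : ∀ L : C(X, ℝ) →L[ℝ] ℝ, L 1 = 0 →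
      (∀ i n, L ((f i).comp (hiter T n : C(X, X))) = 0) → L = 0) :
    ({μ : Measure X | IsProbabilityMeasure μ ∧ Ergodic (⇑T) μ}.encard ≤ (d : ℕ∞) ∧
        topMult T ≤ (d : ℕ∞)) ∨
    ({μ : Measure X | IsProbabilityMeasure μ ∧ Ergodic (⇑T) μ}.encard = (d : ℕ∞) + 1 ∧
        topMult T = (d : ℕ∞) + 1) := by
  classical
  set Erg := {μ : Measure X | IsProbabilityMeasure μ ∧ Ergodic (⇑T) μ} with hErg
  let F1 : Finset C(X, ℝ) := insert 1 (Finset.univ.image f)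
  have hF1 : Dense (Submodule.span ℝ (iterSet T (F1 : Set C(X, ℝ))) : Set C(X, ℝ)) := by
    apply dense_of_forall
    intro L hL
    apply hf L
    · apply hL
      apply Submodule.subset_span
      exact ⟨1, by simp [F1], 0, by ext x; simp⟩
    · intro i n
      apply hL
      apply Submodule.subset_span
      exact ⟨f i, by simp [F1], n, rfl⟩
  have hF1card : F1.card ≤ d + 1 := by
    refine (Finset.card_insert_le _ _).trans ?_
    have := Finset.card_image_le (s := (Finset.univ : Finset (Fin d))) (f := f)
    simp at this
    omega
  have hle1 : topMult T ≤ (d : ℕ∞) + 1 :=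
    (topMult_le T F1 hF1).trans (by exact_mod_cast hF1card)
  have hle2 : Erg.encard ≤ topMult T := encard_le_topMult T
  by_cases hcase : Erg.encard ≤ (d : ℕ∞)
  swap
  · right
    rw [not_le] at hcase
    have h3 := Order.add_one_le_of_lt hcase
    exact ⟨le_antisymm (hle2.trans hle1) h3, le_antisymm hle1 (h3.trans hle2)⟩
  left
  refine ⟨hcase, ?_⟩
  have hfin : Erg.Finite := Set.finite_of_encard_le_coe hcase
  have := hfin.fintype
  have hprob : ∀ e : Erg, IsProbabilityMeasure (e : Measure X) := fun e => e.2.1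
  let S : Submodule ℝ (C(X, ℝ) →L[ℝ] ℝ) :=
    Submodule.span ℝ (Set.range (fun e : Erg => intF (e : Measure X)))
  have hSfin : Module.Finite ℝ S := Module.Finite.span_of_finite ℝ (Set.finite_range _)
  have hSrank : Module.finrank ℝ S ≤ d := by
    refine (finrank_range_le_card _).trans ?_
    rw [Set.encard_eq_coe_toFinset_card, Set.toFinset_card] at hcase
    exact_mod_cast hcase
  -- every invariant functional is in S
  have hinvS : ∀ L : C(X, ℝ) →L[ℝ] ℝ, (∀ g : C(X, ℝ), L (g.comp (T : C(X, X))) = L g) →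
      L ∈ S := by
    have hmeas : ∀ (μ : Measure X) [IsFiniteMeasure μ], MeasurePreserving T μ μ →
        intF μ ∈ S := by
      intro μ _ hμ
      apply mem_span_ergodic T S _ (d + 1) μ hμ
      · intro A hAm hTA hAd
        by_contra! hno
        have hle := card_le_of_linIndep T F1 hF1 (fun j => intF (μ.restrict (A j)))
          (fun j g => by
            apply intF_inv
            have := hμ.restrict_preimage (hAm j)
            rwa [hTA] at this)
          (linIndep_intF _ A (fun j => by
              rw [Measure.restrict_apply_self]; exact hno j)
            (fun i j hij => by
              rw [Measure.restrict_apply (hAm j), (hAd hij.symm).inter_eq, measure_empty]))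
        simp at hle
        omega
      · intro e he hE
        exact Submodule.subset_span ⟨⟨e, he, hE⟩, rfl⟩
    intro L hL
    obtain ⟨α, β, _, _, hα, hβ, rfl⟩ := exists_inv_rep T L hL
    exact S.sub_mem (hmeas α hα) (hmeas β hβ)
  -- choose the shift vector
  let φ : S →ₗ[ℝ] (ℝ × (Fin d → ℝ)) :=
    { toFun := fun L => ((L : C(X, ℝ) →L[ℝ] ℝ) 1, fun i => (L : C(X, ℝ) →L[ℝ] ℝ) (f i))
      map_add' := by intro a b; rfl
      map_smul' := by intro c a; rfl }
  obtain ⟨b, hb⟩ : ∃ b : Fin d → ℝ, ((1 : ℝ), b) ∉ LinearMap.range φ := by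
    by_contra! hall
    have htop : LinearMap.range φ = ⊤ := by
      rw [eq_top_iff]
      rintro ⟨c, b⟩ _
      have h1 := hall (b - c • (0 : Fin d → ℝ))
      have h2 := (LinearMap.range φ).smul_mem (c - 1) (hall 0)
      have h3 := (LinearMap.range φ).add_mem h1 h2
      convert h3 using 1
      ext <;> simp
    have h1 := LinearMap.finrank_range_le φ
    rw [htop, finrank_top, Module.finrank_prod] at h1
    simp at h1
    omega
  let F2 : Finset C(X, ℝ) := Finset.univ.image (fun i => f i - b i • (1 : C(X, ℝ)))
  have hF2card : F2.card ≤ d := by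
    have := Finset.card_image_le (s := (Finset.univ : Finset (Fin d)))
      (f := fun i => f i - b i • (1 : C(X, ℝ)))
    simpa using this
  refine (topMult_le T F2 ?_).trans (by exact_mod_cast hF2card)
  apply dense_of_forall
  intro L hL
  have hLf : ∀ i n, L ((f i).comp (hiter T n : C(X, X))) = b i * L 1 := by
    intro i n
    have h1 := hL ((f i - b i • (1 : C(X, ℝ))).comp (hiter T n : C(X, X)))
      (Submodule.subset_span ⟨_, Finset.mem_coe.2 (Finset.mem_image_of_mem _ (Finset.mem_univ i)),
        n, rfl⟩)
    have h2 : (f i - b i • (1 : C(X, ℝ))).comp (hiter T n : C(X, X)) =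
        (f i).comp (hiter T n : C(X, X)) - b i • (1 : C(X, ℝ)) := by
      ext x; simp
    rw [h2, map_sub, map_smul, smul_eq_mul] at h1
    linarith
  by_cases h1 : L 1 = 0
  · apply hf L h1
    intro i n
    rw [hLf, h1, mul_zero]
  exfalso
  let U : C(X, ℝ) →L[ℝ] C(X, ℝ) :=
    { toFun := fun g => g.comp (T : C(X, X))
      map_add' := fun _ _ => rfl
      map_smul' := fun _ _ => rfl
      cont := ContinuousMap.continuous_precomp _ }
  have hinv : ∀ g : C(X, ℝ), L (g.comp (T : C(X, X))) = L g := by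
    have : L.comp U - L = 0 := by
      apply hf
      · have : U 1 = 1 := by ext x; rfl
        simp [this]
      · intro i n
        have : U ((f i).comp (hiter T n : C(X, X))) =
            (f i).comp (hiter T (n + 1) : C(X, X)) := by
          ext x
          change f i (hiter T n (T x)) = f i (hiter T (n + 1) x)
          rw [hiter_succ']
        rw [sub_apply, ContinuousLinearMap.comp_apply, this, hLf, hLf, sub_self]
    intro g
    have h2 := congrArg (fun M : C(X, ℝ) →L[ℝ] ℝ => M g) (sub_eq_zero.1 this)
    exact h2
  apply hb
  refine ⟨(L 1)⁻¹ • ⟨L, hinvS L hinv⟩, ?_⟩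
  rw [map_smul]
  have hL0 : ∀ i, L (f i) = b i * L 1 := by
    intro i
    rw [← hLf i 0]
    congr 1
  change (L 1)⁻¹ • (L 1, fun i => L (f i)) = (1, b)
  ext i
  · simp [h1]
  · simp only [Prod.smul_mk, Pi.smul_apply, smul_eq_mul, hL0]
    field_simp

end PartD

/-- If the induced system `(M(X), T_*)` embeds affinely, continuously, injectively and
equivariantly in the cubical shift `(([0,1]^d)^ℤ, σ_d)`, then either `(X, T)` has at most
`d` ergodic measures and `Mult(T) ≤ d`, or it has exactly `d + 1` ergodic measures and
`Mult(T) = d + 1`. -/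
theorem mult_le_of_affine_embedding
    {X : Type*} [MetricSpace X] [CompactSpace X] [MeasurableSpace X] [BorelSpace X]
    (T : X ≃ₜ X) (d : ℕ) (hd : 1 ≤ d)
    (Ψ : ProbabilityMeasure X → (ℤ → Fin d → unitInterval))
    (hΨcont : Continuous Ψ) (hΨinj : Function.Injective Ψ)
    (hΨequiv : ∀ μ : ProbabilityMeasure X, Ψ (pushForward T μ) = fun n => Ψ μ (n + 1))
    (hΨaffine : ∀ (μ ν : ProbabilityMeasure X) (t : NNReal) (ht : t ≤ 1) (n : ℤ) (i : Fin d),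
      (Ψ (convComb t ht μ ν) n i : ℝ)
        = (t : ℝ) * (Ψ μ n i : ℝ) + (1 - (t : ℝ)) * (Ψ ν n i : ℝ)) :
    ({μ : Measure X | IsProbabilityMeasure μ ∧ Ergodic (⇑T) μ}.encard ≤ (d : ℕ∞) ∧
        topMult T ≤ (d : ℕ∞)) ∨
    ({μ : Measure X | IsProbabilityMeasure μ ∧ Ergodic (⇑T) μ}.encard = (d : ℕ∞) + 1 ∧
        topMult T = (d : ℕ∞) + 1) := by
  obtain ⟨f, hf⟩ := exists_funcs T d Ψ hΨcont hΨinj hΨequiv hΨaffine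
  exact main_aux T d f hf
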